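/- Let ρ ∈ ℂ be such that 1 − q^{2−4iρ+2j} ≠ 0 and 1 − q^{2+4iρ+2j} ≠ 0 for every integer j ≥ 0, and such that (q^{4iρ};q²)_∞ ≠ 0 and (q^{-4iρ};q²)_∞ ≠ 0. Then for every m ∈ ℕ: φ_ρ(q^{2m}) = [Γ_{q²}(2iρ)/Γ_{q²}(1/2+iρ)²]·ψ_ρ(q^{2m}) + [Γ_{q²}(−2iρ)/Γ_{q²}(1/2−iρ)²]·ψ_{−ρ}(q^{2m}). -/

import Mathlib

open scoped BigOperators
open Complex

noncomputable section

/-- `q^w = exp(w · ln q)` for real `q > 0` and complex `w`. -/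
noncomputable def qpow (q : ℝ) (w : ℂ) : ℂ := Complex.exp (w * (Real.log q : ℂ))

/-- The finite q-Pochhammer symbol `(a;Q)_n = ∏_{j=0}^{n-1} (1 − a Q^j)`. -/
noncomputable def qPoch (a Q : ℂ) (n : ℕ) : ℂ := ∏ j ∈ Finset.range n, (1 - a * Q ^ j)

/-- The infinite q-Pochhammer symbol `(a;Q)_∞ = ∏_{j=0}^{∞} (1 − a Q^j)`. -/
noncomputable def qPochInf (a Q : ℂ) : ℂ := ∏' j : ℕ, (1 - a * Q ^ j)

/-- The eigenvalue `λ(ρ) = −(1−q^{1+2iρ})(1−q^{1−2iρ})/(1−q²)²`. -/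
noncomputable def lambdaQ (q : ℝ) (ρ : ℂ) : ℂ :=
  -((1 - qpow q (1 + 2 * I * ρ)) * (1 - qpow q (1 - 2 * I * ρ))) / (1 - (q : ℂ) ^ 2) ^ 2

/-- The general term of the series defining the Jost-type solution `ψ_ρ(q^{2m})`. -/
noncomputable def psiTerm (q : ℝ) (ρ : ℂ) (m k : ℕ) : ℂ :=
  (qPoch (qpow q (1 - 2 * I * ρ)) ((q : ℂ) ^ 2) k) ^ 2 * (q : ℂ) ^ (2 * k) *
      (q : ℂ) ^ (2 * k * m) /
    (qPoch (qpow q (2 - 4 * I * ρ)) ((q : ℂ) ^ 2) k * qPoch ((q : ℂ) ^ 2) ((q : ℂ) ^ 2) k)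

/-- The Jost-type solution
`ψ_ρ(q^{2m}) = q^{(1−2iρ)m} Σ_{k≥0} ((q^{1−2iρ};q²)_k)² q^{2k} q^{2km} / ((q^{2−4iρ};q²)_k (q²;q²)_k)`. -/
noncomputable def psiQ (q : ℝ) (ρ : ℂ) (m : ℕ) : ℂ :=
  qpow q ((1 - 2 * I * ρ) * (m : ℂ)) * ∑' k : ℕ, psiTerm q ρ m k

/-- The q-spherical function
`φ_ρ(q^{2m}) = Σ_{k=0}^{m} (q^{-2m};q²)_k (q^{1+2iρ};q²)_k (q^{1−2iρ};q²)_k q^{2k} / ((q²;q²)_k)²`. -/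
noncomputable def phiQ (q : ℝ) (ρ : ℂ) (m : ℕ) : ℂ :=
  ∑ k ∈ Finset.range (m + 1),
    qPoch ((q : ℂ) ^ (-(2 * (m : ℤ)))) ((q : ℂ) ^ 2) k *
        qPoch (qpow q (1 + 2 * I * ρ)) ((q : ℂ) ^ 2) k *
        qPoch (qpow q (1 - 2 * I * ρ)) ((q : ℂ) ^ 2) k * (q : ℂ) ^ (2 * k) /
      (qPoch ((q : ℂ) ^ 2) ((q : ℂ) ^ 2) k) ^ 2

/-- The q-Gamma function `Γ_{q²}(x) = (q²;q²)_∞ (1−q²)^{1−x} / (q^{2x};q²)_∞`, using the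
principal branch of the complex power. -/
noncomputable def qGamma (q : ℝ) (x : ℂ) : ℂ :=
  qPochInf ((q : ℂ) ^ 2) ((q : ℂ) ^ 2) * ((1 : ℂ) - (q : ℂ) ^ 2) ^ ((1 : ℂ) - x) /
    qPochInf (qpow q (2 * x)) ((q : ℂ) ^ 2)

open Filter Topology

section Pochhammer

variable {a b Q : ℂ}

lemma qPoch_succ (a Q : ℂ) (n : ℕ) : qPoch a Q (n + 1) = qPoch a Q n * (1 - a * Q ^ n) :=
  Finset.prod_range_succ _ _

lemma qPoch_zero (a Q : ℂ) : qPoch a Q 0 = 1 := rfl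

lemma qPoch_succ' (a Q : ℂ) (n : ℕ) : qPoch a Q (n + 1) = (1 - a) * qPoch (a * Q) Q n := by
  simp only [qPoch, Finset.prod_range_succ', pow_zero, mul_one, pow_succ', mul_assoc]
  rw [mul_comm]

lemma qPoch_ne_zero (h : ∀ k, 1 - a * Q ^ k ≠ 0) (n : ℕ) : qPoch a Q n ≠ 0 :=
  Finset.prod_ne_zero_iff.2 fun k _ ↦ h k

lemma summable_norm_neg_mul_pow (hQ : ‖Q‖ < 1) (a : ℂ) : Summable fun k : ℕ ↦ ‖-(a * Q ^ k)‖ := by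
  simpa only [norm_neg, norm_mul, norm_pow] using
    (summable_geometric_of_lt_one (norm_nonneg _) hQ).mul_left ‖a‖

lemma tendsto_qPoch (hQ : ‖Q‖ < 1) (a : ℂ) :
    Tendsto (qPoch a Q) atTop (𝓝 (qPochInf a Q)) := by
  have h := (multipliable_one_add_of_summable (summable_norm_neg_mul_pow hQ a)).tendsto_prod_tprod_nat
  simp only [← sub_eq_add_neg] at h
  exact h

lemma qPochInf_ne_zero (hQ : ‖Q‖ < 1) (h : ∀ k, 1 - a * Q ^ k ≠ 0) : qPochInf a Q ≠ 0 := by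
  have := tprod_one_add_ne_zero_of_summable (f := fun k : ℕ ↦ -(a * Q ^ k))
    (by simpa only [← sub_eq_add_neg] using h) (summable_norm_neg_mul_pow hQ a)
  simp only [← sub_eq_add_neg] at this
  exact this

lemma one_sub_mul_pow_ne_zero (h : qPochInf a Q ≠ 0) (k : ℕ) : 1 - a * Q ^ k ≠ 0 :=
  fun hk ↦ h (tprod_of_exists_eq_zero ⟨k, hk⟩)

lemma qPochInf_eq_one_sub_mul (hQ : ‖Q‖ < 1) (a : ℂ) :
    qPochInf a Q = (1 - a) * qPochInf (a * Q) Q := by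
  refine tendsto_nhds_unique ((tendsto_qPoch hQ a).comp (tendsto_add_atTop_nat 1)) ?_
  simpa only [Function.comp_def, qPoch_succ'] using (tendsto_qPoch hQ (a * Q)).const_mul (1 - a)

lemma one_sub_pow_succ_ne_zero (hQ : ‖Q‖ < 1) (k : ℕ) : 1 - Q ^ (k + 1) ≠ 0 := by
  intro h
  have h1 : ‖Q ^ (k + 1)‖ = 1 := by rw [← sub_eq_zero.1 h, norm_one]
  rw [norm_pow] at h1
  exact (pow_lt_one₀ (norm_nonneg _) hQ (Nat.succ_ne_zero k)).ne h1

lemma one_sub_mul_self_pow_ne_zero (hQ : ‖Q‖ < 1) (k : ℕ) : 1 - Q * Q ^ k ≠ 0 := by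
  rw [← pow_succ']
  exact one_sub_pow_succ_ne_zero hQ k

end Pochhammer

section Telescoping

lemma tsum_eq_sub_of_telescope {f v : ℕ → ℂ} {L : ℂ} (hf : Summable f)
    (h : ∀ k, f k = v k - v (k + 1)) (hv : Tendsto v atTop (𝓝 L)) : ∑' k, f k = v 0 - L := by
  refine tendsto_nhds_unique hf.hasSum.tendsto_sum_nat ?_
  simp only [h, Finset.sum_range_sub']
  exact tendsto_const_nhds.sub hv

lemma summable_pow_mul_of_tendsto {Q : ℂ} (hQ : ‖Q‖ < 1) {w : ℕ → ℂ} {L : ℂ}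
    (hw : Tendsto w atTop (𝓝 L)) : Summable fun k ↦ Q ^ k * w k := by
  refine summable_of_isBigO_nat (summable_geometric_of_lt_one (norm_nonneg _) hQ) ?_
  have h1 : (fun k : ℕ ↦ Q ^ k) =O[atTop] fun k ↦ ‖Q‖ ^ k :=
    Asymptotics.IsBigO.of_bound 1 (by simp)
  simpa using h1.mul (hw.isBigO_one ℝ)

end Telescoping

section Jost

variable {a b Q : ℂ}

/-- The coefficients `(a;Q)_k² / ((a²;Q)_k (Q;Q)_k)` of the series `₂φ₁(a, a; a²; Q, z)`. -/
def jostCoeff (a Q : ℂ) (k : ℕ) : ℂ :=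
  qPoch a Q k ^ 2 / (qPoch (a ^ 2) Q k * qPoch Q Q k)

/-- The limit of `jostCoeff a Q k` as `k → ∞`. -/
def jostCoeffLim (a Q : ℂ) : ℂ :=
  qPochInf a Q ^ 2 / (qPochInf (a ^ 2) Q * qPochInf Q Q)

/-- The moments `∑ k, c_k Q^k (a Q^k)^m` of the Jost coefficients `c_k`. -/
def jostSum (a Q : ℂ) (m : ℕ) : ℂ := ∑' k : ℕ, Q ^ k * (jostCoeff a Q k * (a * Q ^ k) ^ m)

/-- The generating function `∑ k, c_k Q^k / (1 - a Q^k t)` of the moments `jostSum a Q m`. -/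
def jostGen (a Q t : ℂ) : ℂ := ∑' k : ℕ, Q ^ k * (jostCoeff a Q k * (1 - a * Q ^ k * t)⁻¹)

lemma jostCoeff_zero (a Q : ℂ) : jostCoeff a Q 0 = 1 := by simp [jostCoeff, qPoch_zero]

lemma jostCoeff_succ_mul (hQ : ‖Q‖ < 1) (ha : ∀ k, 1 - a ^ 2 * Q ^ k ≠ 0) (k : ℕ) :
    jostCoeff a Q (k + 1) * ((1 - a ^ 2 * Q ^ k) * (1 - Q ^ (k + 1)))
      = jostCoeff a Q k * (1 - a * Q ^ k) ^ 2 := by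
  have h1 := qPoch_ne_zero ha k
  have h2 := qPoch_ne_zero (one_sub_mul_self_pow_ne_zero hQ) k
  have h3 := ha k
  have h4 := one_sub_pow_succ_ne_zero hQ k
  simp only [jostCoeff, qPoch_succ, ← pow_succ']
  field_simp

lemma tendsto_jostCoeff (hQ : ‖Q‖ < 1) (ha : ∀ k, 1 - a ^ 2 * Q ^ k ≠ 0) :
    Tendsto (jostCoeff a Q) atTop (𝓝 (jostCoeffLim a Q)) :=
  ((tendsto_qPoch hQ a).pow 2).div ((tendsto_qPoch hQ (a ^ 2)).mul (tendsto_qPoch hQ Q))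
    (mul_ne_zero (qPochInf_ne_zero hQ ha)
      (qPochInf_ne_zero hQ (one_sub_mul_self_pow_ne_zero hQ)))

lemma tendsto_mul_pow_zero (hQ : ‖Q‖ < 1) (a : ℂ) :
    Tendsto (fun k : ℕ ↦ a * Q ^ k) atTop (𝓝 0) := by
  simpa using (tendsto_pow_atTop_nhds_zero_of_norm_lt_one hQ).const_mul a

lemma tendsto_inv_one_sub (hQ : ‖Q‖ < 1) (a t : ℂ) :
    Tendsto (fun k : ℕ ↦ (1 - a * Q ^ k * t)⁻¹) atTop (𝓝 1) := by
  simpa using (((tendsto_mul_pow_zero hQ a).mul_const t).const_sub 1).inv₀ (by simp)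

lemma summable_jostSum (hQ : ‖Q‖ < 1) (ha : ∀ k, 1 - a ^ 2 * Q ^ k ≠ 0) (m : ℕ) :
    Summable fun k : ℕ ↦ Q ^ k * (jostCoeff a Q k * (a * Q ^ k) ^ m) :=
  summable_pow_mul_of_tendsto hQ ((tendsto_jostCoeff hQ ha).mul ((tendsto_mul_pow_zero hQ a).pow m))

lemma summable_jostGen (hQ : ‖Q‖ < 1) (ha : ∀ k, 1 - a ^ 2 * Q ^ k ≠ 0) (t : ℂ) :
    Summable fun k : ℕ ↦ Q ^ k * (jostCoeff a Q k * (1 - a * Q ^ k * t)⁻¹) :=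
  summable_pow_mul_of_tendsto hQ ((tendsto_jostCoeff hQ ha).mul (tendsto_inv_one_sub hQ a t))

lemma jostSum_recurrence (hQ : ‖Q‖ < 1) (hab : a * b = Q) (ha : ∀ k, 1 - a ^ 2 * Q ^ k ≠ 0)
    (m : ℕ) :
    (1 - Q ^ (m + 2)) * jostSum a Q (m + 2) - (a + b - 2 * Q ^ (m + 2)) * jostSum a Q (m + 1)
      + Q * (1 - Q ^ (m + 1)) * jostSum a Q m = 0 := by
  have h2 := (summable_jostSum hQ ha (m + 2)).mul_left (1 - Q ^ (m + 2))
  have h1 := (summable_jostSum hQ ha (m + 1)).mul_left (a + b - 2 * Q ^ (m + 2))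
  have h0 := (summable_jostSum hQ ha m).mul_left (Q * (1 - Q ^ (m + 1)))
  simp only [jostSum, ← tsum_mul_left]
  rw [← h2.tsum_sub h1, ← (h2.sub h1).tsum_add h0]
  have hu := tendsto_mul_pow_zero hQ a
  have hv : Tendsto (fun k ↦ Q ^ k * (jostCoeff a Q k * (a * Q ^ k) ^ m)
      * ((a * Q ^ k - a) * (a * Q ^ k - b))) atTop (𝓝 0) := by
    simpa using (summable_jostSum hQ ha m).tendsto_atTop_zero.mul
      ((hu.sub_const a).mul (hu.sub_const b))
  rw [tsum_eq_sub_of_telescope ((h2.sub h1).add h0) (fun k ↦ ?_) hv]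
  · simp
  · have hc := jostCoeff_succ_mul hQ ha k
    have e : (a * Q ^ (k + 1) - a) * (a * Q ^ (k + 1) - b)
        = Q * ((1 - a ^ 2 * Q ^ k) * (1 - Q ^ (k + 1))) := by
      rw [pow_succ, ← hab]; ring
    have e2 : Q ^ (k + 1) * (jostCoeff a Q (k + 1) * (a * Q ^ (k + 1)) ^ m)
        * ((a * Q ^ (k + 1) - a) * (a * Q ^ (k + 1) - b))
        = Q ^ (m + 2) * Q ^ k * (a * Q ^ k) ^ m * (jostCoeff a Q k * (1 - a * Q ^ k) ^ 2) := by
      rw [e, ← hc]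
      ring
    rw [e2]
    linear_combination (-(Q ^ k * jostCoeff a Q k * (a * Q ^ k) ^ m)) * hab

lemma jostSum_one (hQ : ‖Q‖ < 1) (hab : a * b = Q) (ha : ∀ k, 1 - a ^ 2 * Q ^ k ≠ 0) :
    (1 - Q) * jostSum a Q 1 - (a + b - 2 * Q) * jostSum a Q 0 = -(b * jostCoeffLim a Q) := by
  have h1 := (summable_jostSum hQ ha 1).mul_left (1 - Q)
  have h0 := (summable_jostSum hQ ha 0).mul_left (a + b - 2 * Q)
  simp only [jostSum, ← tsum_mul_left]
  rw [← h1.tsum_sub h0]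
  have hu := tendsto_mul_pow_zero hQ a
  have hv : Tendsto (fun k ↦ -(jostCoeff a Q k * (1 - 1 * Q ^ k) * (a * Q ^ k - b))) atTop
      (𝓝 (b * jostCoeffLim a Q)) := by
    have := (((tendsto_jostCoeff hQ ha).mul ((tendsto_mul_pow_zero hQ 1).const_sub 1)).mul
      (hu.sub_const b)).neg
    convert this using 2
    ring
  rw [tsum_eq_sub_of_telescope (h1.sub h0) (fun k ↦ ?_) hv]
  · simp
  · have hc := jostCoeff_succ_mul hQ ha k
    have e : jostCoeff a Q (k + 1) * (1 - 1 * Q ^ (k + 1)) * (a * Q ^ (k + 1) - b)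
        = -(b * (jostCoeff a Q k * (1 - a * Q ^ k) ^ 2)) := by
      rw [← hc, pow_succ, ← hab]; ring
    rw [e, ← hab]
    ring

lemma jostGen_functional (hQ : ‖Q‖ < 1) (hab : a * b = Q) (ha : ∀ k, 1 - a ^ 2 * Q ^ k ≠ 0)
    {t : ℂ} (ht : ∀ k, 1 - a * Q ^ k * t ≠ 0) :
    (1 - a * t) * (1 - b * t) * jostGen a Q t - (1 - Q * t) ^ 2 * jostGen a Q (Q * t)
      = -(t * (b * jostCoeffLim a Q)) := by
  have h1 := (summable_jostGen hQ ha t).mul_left ((1 - a * t) * (1 - b * t))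
  have h0 := (summable_jostGen hQ ha (Q * t)).mul_left ((1 - Q * t) ^ 2)
  simp only [jostGen, ← tsum_mul_left]
  rw [← h1.tsum_sub h0]
  have hu := tendsto_mul_pow_zero hQ a
  have hv : Tendsto (fun k ↦ -(t * (jostCoeff a Q k * (1 - 1 * Q ^ k) * (a * Q ^ k - b)
      * (1 - a * Q ^ k * t)⁻¹))) atTop (𝓝 (t * (b * jostCoeffLim a Q))) := by
    have := (((((tendsto_jostCoeff hQ ha).mul ((tendsto_mul_pow_zero hQ 1).const_sub 1)).mul
      (hu.sub_const b)).mul (tendsto_inv_one_sub hQ a t)).const_mul t).neg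
    convert this using 2
    ring
  rw [tsum_eq_sub_of_telescope (h1.sub h0) (fun k ↦ ?_) hv]
  · simp
  · have hc := jostCoeff_succ_mul hQ ha k
    have e : jostCoeff a Q (k + 1) * (1 - 1 * Q ^ (k + 1)) * (a * Q ^ (k + 1) - b)
        = -(b * (jostCoeff a Q k * (1 - a * Q ^ k) ^ 2)) := by
      rw [← hc, pow_succ, ← hab]; ring
    rw [e]
    have e1 := ht k
    have e2 : 1 - a * Q ^ k * (Q * t) ≠ 0 := by
      have := ht (k + 1)
      rwa [pow_succ, ← mul_assoc, mul_assoc _ Q t] at this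
    rw [show a * Q ^ (k + 1) * t = a * Q ^ k * (Q * t) by ring]
    have hX := inv_mul_cancel₀ e1
    have hY := inv_mul_cancel₀ e2
    generalize (1 - a * Q ^ k * t)⁻¹ = X at *
    generalize (1 - a * Q ^ k * (Q * t))⁻¹ = Y at *
    generalize Q ^ k = s at *
    subst hab
    linear_combination jostCoeff a (a * b) k * (s - b * t) * (hX - hY)

lemma jostGen_at_pole (hQ : ‖Q‖ < 1) (hab : a * b = Q)
    (ha : ∀ k, 1 - a ^ 2 * Q ^ k ≠ 0) :
    (a - b) - a * (1 - b) ^ 2 * jostGen a Q b = -(b * jostCoeffLim a Q) := by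
  have h0 := (summable_jostGen hQ ha b).mul_left (a * (1 - b) ^ 2)
  simp only [jostGen, ← tsum_mul_left]
  have hu := tendsto_mul_pow_zero hQ a
  have hv : Tendsto (fun k ↦ jostCoeff a Q k * (a * Q ^ k - b)) atTop
      (𝓝 (-(b * jostCoeffLim a Q))) := by
    have := (tendsto_jostCoeff hQ ha).mul (hu.sub_const b)
    convert this using 2
    ring
  rw [tsum_eq_sub_of_telescope h0 (fun k ↦ ?_) hv]
  · simp [jostCoeff_zero]
  · have hc := jostCoeff_succ_mul hQ ha k
    have hk := one_sub_pow_succ_ne_zero hQ k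
    have e : jostCoeff a Q (k + 1) * (a * Q ^ (k + 1) - b) * (1 - Q ^ (k + 1))
        = -(b * (jostCoeff a Q k * (1 - a * Q ^ k) ^ 2)) := by
      rw [← hc, pow_succ, ← hab]; ring
    rw [← eq_div_iff hk] at e
    rw [e]
    have e3 : a * Q ^ k * b = Q ^ (k + 1) := by rw [pow_succ, ← hab]; ring
    rw [e3]
    have hX := inv_mul_cancel₀ hk
    rw [div_eq_mul_inv]
    generalize (1 - Q ^ (k + 1))⁻¹ = X at *
    rw [pow_succ] at hX
    generalize Q ^ k = s at *
    subst hab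
    linear_combination jostCoeff a (a * b) k * (a * s - b) * hX

lemma tendsto_jostGen (hQ : ‖Q‖ < 1) (ha : ∀ k, 1 - a ^ 2 * Q ^ k ≠ 0) (t : ℂ) :
    Tendsto (fun n : ℕ ↦ jostGen a Q (Q ^ n * t)) atTop (𝓝 (jostSum a Q 0)) := by
  have e : ∀ k n : ℕ, a * Q ^ k * (Q ^ n * t) = a * Q ^ (k + n) * t := fun k n ↦ by
    rw [pow_add]; ring
  obtain ⟨M, hM⟩ := (tendsto_inv_one_sub hQ a t).norm.bddAbove_range
  have h0 := ((summable_jostSum hQ ha 0).norm).mul_right M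
  refine tendsto_tsum_of_dominated_convergence h0 (fun k ↦ ?_) (Eventually.of_forall fun n k ↦ ?_)
  · simp only [e, pow_zero]
    refine ((Tendsto.comp (tendsto_inv_one_sub hQ a t) ?_).const_mul _).const_mul _
    exact tendsto_atTop_mono (fun n ↦ Nat.le_add_left n k) tendsto_id
  · simp only [e, pow_zero, mul_one]
    rw [← mul_assoc, norm_mul]
    exact mul_le_mul_of_nonneg_left (hM ⟨k + n, rfl⟩) (norm_nonneg _)

end Jost

section Connection

variable {a b Q : ℂ}

/-- The connection coefficient `(b;Q)_∞² / ((Q;Q)_∞ (b/a;Q)_∞)`. -/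
def connCoeff (a b Q : ℂ) : ℂ := qPochInf b Q ^ 2 / (qPochInf Q Q * qPochInf (b / a) Q)

lemma one_sub_sq_mul_pow_ne_zero (hab : a * b = Q) (hb0 : b ≠ 0) (h : qPochInf (a / b) Q ≠ 0)
    (k : ℕ) : 1 - a ^ 2 * Q ^ k ≠ 0 := by
  have h1 := one_sub_mul_pow_ne_zero h (k + 1)
  rwa [pow_succ', ← mul_assoc, show a / b * Q = a ^ 2 by rw [← hab]; field_simp] at h1

lemma qPochInf_div_eq (hQ : ‖Q‖ < 1) (hab : a * b = Q) (hb0 : b ≠ 0) :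
    qPochInf (a / b) Q = (1 - a / b) * qPochInf (a ^ 2) Q := by
  rw [qPochInf_eq_one_sub_mul hQ, show a / b * Q = a ^ 2 by rw [← hab]; field_simp]

lemma connCoeff_mul_jostCoeffLim (hQ : ‖Q‖ < 1) (hab : a * b = Q) (ha0 : a ≠ 0) (hb0 : b ≠ 0)
    (hA : qPochInf (b / a) Q ≠ 0) (hB : qPochInf (a / b) Q ≠ 0) :
    connCoeff a b Q * (b * jostCoeffLim a Q) + connCoeff b a Q * (a * jostCoeffLim b Q) = 0 := by
  have hba : b * a = Q := by rw [mul_comm, hab]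
  have hPQ := qPochInf_ne_zero hQ (one_sub_mul_self_pow_ne_zero hQ)
  rw [qPochInf_div_eq hQ hba ha0] at hA
  rw [qPochInf_div_eq hQ hab hb0] at hB
  simp only [connCoeff, jostCoeffLim, qPochInf_div_eq hQ hba ha0, qPochInf_div_eq hQ hab hb0]
  have h1 := left_ne_zero_of_mul hA
  have h2 := right_ne_zero_of_mul hA
  have h4 := right_ne_zero_of_mul hB
  have h5 : a - b ≠ 0 := fun h ↦ h1 (by rw [sub_eq_zero.1 h, div_self hb0, sub_self])
  have e1 : 1 - b / a = (a - b) / a := by field_simp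
  have e2 : 1 - a / b = -((a - b) / b) := by field_simp; ring
  rw [e1, e2]
  field_simp
  ring

lemma connCoeff_functional (hQ : ‖Q‖ < 1) (hab : a * b = Q) (ha0 : a ≠ 0) (hb0 : b ≠ 0)
    (hA : qPochInf (b / a) Q ≠ 0) (hB : qPochInf (a / b) Q ≠ 0) {t : ℂ}
    (ht : ∀ k, 1 - a * Q ^ k * t ≠ 0) (ht' : ∀ k, 1 - b * Q ^ k * t ≠ 0) :
    (1 - a * t) * (1 - b * t) * (connCoeff a b Q * jostGen a Q t + connCoeff b a Q * jostGen b Q t)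
      = (1 - Q * t) ^ 2 *
        (connCoeff a b Q * jostGen a Q (Q * t) + connCoeff b a Q * jostGen b Q (Q * t)) := by
  have hba : b * a = Q := by rw [mul_comm, hab]
  have h1 := jostGen_functional hQ hab (one_sub_sq_mul_pow_ne_zero hab hb0 hB) ht
  have h2 := jostGen_functional hQ hba (one_sub_sq_mul_pow_ne_zero hba ha0 hA) ht'
  have h3 := connCoeff_mul_jostCoeffLim hQ hab ha0 hb0 hA hB
  linear_combination connCoeff a b Q * h1 + connCoeff b a Q * h2 - t * h3

lemma connCoeff_at_pole (hQ : ‖Q‖ < 1) (hab : a * b = Q) (ha0 : a ≠ 0) (hb0 : b ≠ 0)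
    (hA : qPochInf (b / a) Q ≠ 0) (hB : qPochInf (a / b) Q ≠ 0) :
    (1 - b) ^ 2 * (connCoeff a b Q * jostGen a Q b + connCoeff b a Q * jostGen b Q b)
      = (1 - b / a) * connCoeff a b Q := by
  have hba : b * a = Q := by rw [mul_comm, hab]
  have h1 := jostGen_at_pole hQ hab (one_sub_sq_mul_pow_ne_zero hab hb0 hB)
  have h2 := jostGen_functional hQ hba (one_sub_sq_mul_pow_ne_zero hba ha0 hA) (t := a⁻¹)
    (fun k ↦ by
      rw [mul_right_comm, ← div_eq_mul_inv]
      exact one_sub_mul_pow_ne_zero hA k)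
  have h3 := connCoeff_mul_jostCoeffLim hQ hab ha0 hb0 hA hB
  rw [show Q * a⁻¹ = b by rw [← hab]; field_simp, mul_inv_cancel₀ ha0] at h2
  have e1 : a⁻¹ * (a * jostCoeffLim b Q) = jostCoeffLim b Q := by field_simp
  rw [e1] at h2
  have e2 : a * (1 - b / a) = a - b := by field_simp
  refine mul_left_cancel₀ ha0 ?_
  linear_combination (-connCoeff a b Q) * h1 - a * connCoeff b a Q * h2 + h3 - connCoeff a b Q * e2

/-- The nonterminating `q`-Chu–Vandermonde sum in the case needed here. -/
lemma connCoeff_mul_jostSum_zero (hQ : ‖Q‖ < 1) (hab : a * b = Q) (ha0 : a ≠ 0) (hb0 : b ≠ 0)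
    (hA : qPochInf (b / a) Q ≠ 0) (hB : qPochInf (a / b) Q ≠ 0) :
    connCoeff a b Q * jostSum a Q 0 + connCoeff b a Q * jostSum b Q 0 = 1 := by
  have hba : b * a = Q := by rw [mul_comm, hab]
  have ha := one_sub_sq_mul_pow_ne_zero hab hb0 hB
  have hb := one_sub_sq_mul_pow_ne_zero hba ha0 hA
  let G : ℕ → ℂ := fun n ↦
    connCoeff a b Q * jostGen a Q (Q ^ n * b) + connCoeff b a Q * jostGen b Q (Q ^ n * b)
  have hG : Tendsto G atTop
      (𝓝 (connCoeff a b Q * jostSum a Q 0 + connCoeff b a Q * jostSum b Q 0)) :=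
    ((tendsto_jostGen hQ ha b).const_mul _).add ((tendsto_jostGen hQ hb b).const_mul _)
  have hstep : ∀ n, (1 - Q * Q ^ n) * (1 - b ^ 2 * Q ^ n) * G n
      = (1 - b * Q ^ (n + 1)) ^ 2 * G (n + 1) := fun n ↦ by
    have := connCoeff_functional hQ hab ha0 hb0 hA hB (t := Q ^ n * b)
      (fun k ↦ by
        have e : a * Q ^ k * (Q ^ n * b) = Q * Q ^ (k + n) := by
          rw [pow_add]
          linear_combination Q ^ k * Q ^ n * hab
        rw [e]
        exact one_sub_mul_self_pow_ne_zero hQ _)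
      (fun k ↦ by
        rw [show b * Q ^ k * (Q ^ n * b) = b ^ 2 * Q ^ (k + n) by rw [pow_add]; ring]
        exact hb _)
    rw [show a * (Q ^ n * b) = Q * Q ^ n by linear_combination Q ^ n * hab,
      show b * (Q ^ n * b) = b ^ 2 * Q ^ n by ring,
      show Q * (Q ^ n * b) = Q ^ (n + 1) * b by ring] at this
    rw [mul_comm b]
    exact this
  have hprod : ∀ n, qPoch b Q (n + 1) ^ 2 * G n
      = qPoch Q Q n * qPoch (b ^ 2) Q n * ((1 - b / a) * connCoeff a b Q) := fun n ↦ by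
    induction n with
    | zero =>
      rw [← connCoeff_at_pole hQ hab ha0 hb0 hA hB]
      simp [G, qPoch_succ, qPoch_zero]
    | succ n ih =>
      rw [qPoch_succ b, qPoch_succ Q, qPoch_succ (b ^ 2)]
      linear_combination (1 - Q * Q ^ n) * (1 - b ^ 2 * Q ^ n) * ih - qPoch b Q (n + 1) ^ 2 * hstep n
  have hlim := tendsto_nhds_unique
    ((((tendsto_qPoch hQ b).comp (tendsto_add_atTop_nat 1)).pow 2).mul hG)
    ((((tendsto_qPoch hQ Q).mul (tendsto_qPoch hQ (b ^ 2))).mul_const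
      ((1 - b / a) * connCoeff a b Q)).congr fun n ↦ (hprod n).symm)
  have hPQ := qPochInf_ne_zero hQ (one_sub_mul_self_pow_ne_zero hQ)
  have hPb : qPochInf b Q ≠ 0 := by
    refine qPochInf_ne_zero hQ fun k hk ↦ hb (2 * k) ?_
    rw [mul_comm 2 k, pow_mul]
    linear_combination (1 + b * Q ^ k) * hk
  have hc : qPochInf Q Q * qPochInf (b / a) Q * connCoeff a b Q = qPochInf b Q ^ 2 :=
    mul_div_cancel₀ _ (mul_ne_zero hPQ hA)
  rw [qPochInf_div_eq hQ hba ha0] at hc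
  refine mul_left_cancel₀ (pow_ne_zero 2 hPb) ?_
  linear_combination hlim + hc

end Connection

section Spherical

variable {a b Q : ℂ}

/-- The coefficients `(b;Q)_k (a;Q)_k Q^k / (Q;Q)_k²` of the spherical function. -/
def sphCoeff (a b Q : ℂ) (k : ℕ) : ℂ :=
  qPoch b Q k * qPoch a Q k * Q ^ k / qPoch Q Q k ^ 2

/-- The partial sums of `₃φ₂(x, b, a; Q, 0; Q, Q)`. -/
def sphSum (a b Q x : ℂ) (n : ℕ) : ℂ := ∑ k ∈ Finset.range n, sphCoeff a b Q k * qPoch x Q k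

lemma sphCoeff_succ_mul (hQ : ‖Q‖ < 1) (k : ℕ) :
    sphCoeff a b Q (k + 1) * (1 - Q ^ (k + 1)) ^ 2
      = sphCoeff a b Q k * (Q * (1 - a * Q ^ k) * (1 - b * Q ^ k)) := by
  have h2 := qPoch_ne_zero (one_sub_mul_self_pow_ne_zero hQ) k
  have h4 := one_sub_pow_succ_ne_zero hQ k
  simp only [sphCoeff, qPoch_succ, ← pow_succ']
  field_simp
  ring

lemma sphSum_contiguous (hQ : ‖Q‖ < 1) (hab : a * b = Q) (hQ0 : Q ≠ 0) {x : ℂ} (hx : x ≠ 0)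
    (n : ℕ) :
    (1 - Q / x) * sphSum a b Q (x / Q) (n + 1) - (a + b - 2 * (Q / x)) * sphSum a b Q x (n + 1)
        + Q * (1 - 1 / x) * sphSum a b Q (x * Q) (n + 1)
      = sphCoeff a b Q n * (Q ^ n)⁻¹ * (1 - a * Q ^ n) * (1 - b * Q ^ n) * qPoch x Q n := by
  induction n with
  | zero =>
    simp [sphSum, sphCoeff, qPoch_zero]
    field_simp
    linear_combination -x * hab
  | succ n ih =>
    simp only [sphSum, Finset.sum_range_succ _ (n + 1)] at ih ⊢
    have hw := sphCoeff_succ_mul (a := a) (b := b) hQ n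
    have e1 : qPoch (x / Q) Q (n + 1) = (1 - x / Q) * qPoch x Q n := by
      rw [qPoch_succ', div_mul_cancel₀ _ hQ0]
    have e2 : (1 - x) * qPoch (x * Q) Q (n + 1)
        = qPoch x Q n * (1 - x * Q ^ n) * (1 - x * Q ^ (n + 1)) := by
      rw [← qPoch_succ', qPoch_succ, qPoch_succ]
    have e3 := qPoch_succ x Q n
    have e4 : Q * (1 - 1 / x) * (sphCoeff a b Q (n + 1) * qPoch (x * Q) Q (n + 1))
        = -(Q / x) * sphCoeff a b Q (n + 1)
          * (qPoch x Q n * (1 - x * Q ^ n) * (1 - x * Q ^ (n + 1))) := by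
      rw [← e2]; field_simp; ring
    have hs : Q ^ n ≠ 0 := pow_ne_zero _ hQ0
    have e5 : sphCoeff a b Q n * (Q ^ n)⁻¹ * (1 - a * Q ^ n) * (1 - b * Q ^ n) * qPoch x Q n
        = sphCoeff a b Q (n + 1) * (1 - Q ^ (n + 1)) ^ 2 * (Q ^ (n + 1))⁻¹ * qPoch x Q n := by
      rw [hw, pow_succ]; field_simp
    rw [e5] at ih
    simp only [mul_add, e4]
    rw [e1, e3]
    have key : (1 - Q / x) * (sphCoeff a b Q (n + 1) * ((1 - x / Q) * qPoch x Q n))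
          - (a + b - 2 * (Q / x)) * (sphCoeff a b Q (n + 1) * (qPoch x Q n * (1 - x * Q ^ n)))
          + -(Q / x) * sphCoeff a b Q (n + 1)
            * (qPoch x Q n * (1 - x * Q ^ n) * (1 - x * Q ^ (n + 1)))
        = sphCoeff a b Q (n + 1) * (Q ^ (n + 1))⁻¹ * (1 - a * Q ^ (n + 1))
            * (1 - b * Q ^ (n + 1)) * (qPoch x Q n * (1 - x * Q ^ n))
          - sphCoeff a b Q (n + 1) * (1 - Q ^ (n + 1)) ^ 2 * (Q ^ (n + 1))⁻¹ * qPoch x Q n := by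
      rw [pow_succ]
      generalize sphCoeff a b Q (n + 1) = w
      generalize qPoch x Q n = e
      generalize Q ^ n = s at *
      have ha0 : a ≠ 0 := left_ne_zero_of_mul (hab ▸ hQ0)
      have hb0 : b ≠ 0 := right_ne_zero_of_mul (hab ▸ hQ0)
      subst hab
      field_simp
      ring
    linear_combination ih + key

lemma qPoch_inv_pow_eq_zero (hQ0 : Q ≠ 0) {m k : ℕ} (h : m < k) : qPoch (Q⁻¹ ^ m) Q k = 0 := by
  refine Finset.prod_eq_zero (Finset.mem_range.2 h) ?_
  rw [← mul_pow, inv_mul_cancel₀ hQ0, one_pow, sub_self]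

lemma sphSum_inv_pow (hQ0 : Q ≠ 0) {m n : ℕ} (h : m + 1 ≤ n) :
    sphSum a b Q (Q⁻¹ ^ m) n = sphSum a b Q (Q⁻¹ ^ m) (m + 1) := by
  refine (Finset.sum_subset (Finset.range_mono h) fun k _ hk ↦ ?_).symm
  rw [qPoch_inv_pow_eq_zero hQ0 (by simpa using hk), mul_zero]

lemma sphSum_inv_pow_contiguous (hQ : ‖Q‖ < 1) (hab : a * b = Q) (hQ0 : Q ≠ 0) (m n : ℕ)
    (h : m + 2 ≤ n) :
    (1 - Q ^ (m + 1)) * sphSum a b Q (Q⁻¹ ^ (m + 1)) n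
        - (a + b - 2 * Q ^ (m + 1)) * sphSum a b Q (Q⁻¹ ^ m) n
        + Q * (1 - Q ^ m) * sphSum a b Q (Q⁻¹ ^ m * Q) n = 0 := by
  obtain ⟨n, rfl⟩ : ∃ l, n = l + 1 := ⟨n - 1, by omega⟩
  have := sphSum_contiguous hQ hab hQ0 (pow_ne_zero m (inv_ne_zero hQ0)) n
  rw [qPoch_inv_pow_eq_zero hQ0 (show m < n by omega), mul_zero] at this
  rw [← this]
  have e1 : Q⁻¹ ^ m / Q = Q⁻¹ ^ (m + 1) := by rw [pow_succ, div_eq_mul_inv]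
  have e2 : Q / Q⁻¹ ^ m = Q ^ (m + 1) := by rw [inv_pow, div_inv_eq_mul, pow_succ']
  have e3 : 1 / Q⁻¹ ^ m = Q ^ m := by rw [inv_pow, one_div, inv_inv]
  rw [e1, e2, e3]

lemma sphSum_eq_connCoeff (hQ : ‖Q‖ < 1) (hab : a * b = Q) (ha0 : a ≠ 0) (hb0 : b ≠ 0)
    (hA : qPochInf (b / a) Q ≠ 0) (hB : qPochInf (a / b) Q ≠ 0) (m : ℕ) :
    sphSum a b Q (Q⁻¹ ^ m) (m + 1)
      = connCoeff a b Q * jostSum a Q m + connCoeff b a Q * jostSum b Q m := by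
  have hba : b * a = Q := by rw [mul_comm, hab]
  have hQ0 : Q ≠ 0 := hab ▸ mul_ne_zero ha0 hb0
  have ha := one_sub_sq_mul_pow_ne_zero hab hb0 hB
  have hb := one_sub_sq_mul_pow_ne_zero hba ha0 hA
  have h0 := connCoeff_mul_jostSum_zero hQ hab ha0 hb0 hA hB
  induction m using Nat.twoStepInduction with
  | zero => rw [h0]; simp [sphSum, sphCoeff, qPoch_zero]
  | one =>
    have h1 := jostSum_one hQ hab ha
    have h2 := jostSum_one hQ hba hb
    have h3 := connCoeff_mul_jostCoeffLim hQ hab ha0 hb0 hA hB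
    have h4 := sphSum_inv_pow_contiguous hQ hab hQ0 0 2 le_rfl
    rw [sphSum_inv_pow hQ0 (show 0 + 1 ≤ 2 by norm_num)] at h4
    have h5 : sphSum a b Q (Q⁻¹ ^ 0) (0 + 1) = 1 := by simp [sphSum, sphCoeff, qPoch_zero]
    rw [h5] at h4
    refine mul_left_cancel₀ (one_sub_pow_succ_ne_zero hQ 0) ?_
    simp only [zero_add, pow_zero, pow_one, sub_self, mul_zero, zero_mul, add_zero] at h4 ⊢
    linear_combination h4 - connCoeff a b Q * h1 - connCoeff b a Q * h2 + h3
      - (a + b - 2 * Q) * h0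
  | more m ih0 ih1 =>
    have h1 := jostSum_recurrence hQ hab ha m
    have h2 := jostSum_recurrence hQ hba hb m
    have h4 := sphSum_inv_pow_contiguous hQ hab hQ0 (m + 1) (m + 3) le_rfl
    have e : Q⁻¹ ^ (m + 1) * Q = Q⁻¹ ^ m := by
      rw [pow_succ, mul_assoc, inv_mul_cancel₀ hQ0, mul_one]
    rw [e, sphSum_inv_pow hQ0 (show m + 1 + 1 ≤ m + 3 by omega),
      sphSum_inv_pow hQ0 (show m + 1 ≤ m + 3 by omega), ih0, ih1] at h4
    refine mul_left_cancel₀ (one_sub_pow_succ_ne_zero hQ (m + 1)) ?_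
    linear_combination h4 - connCoeff a b Q * h1 - connCoeff b a Q * h2

end Spherical

section QPow

variable {q : ℝ}

lemma qpow_add (q : ℝ) (w z : ℂ) : qpow q (w + z) = qpow q w * qpow q z := by
  rw [qpow, add_mul, Complex.exp_add]; rfl

lemma qpow_ne_zero (q : ℝ) (w : ℂ) : qpow q w ≠ 0 := Complex.exp_ne_zero _

lemma qpow_sub (q : ℝ) (w z : ℂ) : qpow q (w - z) = qpow q w / qpow q z := by
  rw [qpow, sub_mul, Complex.exp_sub]; rfl

lemma qpow_mul_natCast (q : ℝ) (w : ℂ) (m : ℕ) : qpow q (w * m) = qpow q w ^ m := by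
  rw [qpow, qpow, ← Complex.exp_nat_mul]
  ring_nf

lemma qpow_two (hq : 0 < q) : qpow q 2 = (q : ℂ) ^ 2 := by
  rw [qpow, show (2 : ℂ) * (Real.log q : ℂ) = (2 : ℕ) * (Real.log q : ℂ) by norm_num,
    Complex.exp_nat_mul, ← Complex.ofReal_exp, Real.exp_log hq]

lemma psiQ_eq_jostSum (q : ℝ) (ρ : ℂ) (m : ℕ) :
    psiQ q ρ m = jostSum (qpow q (1 - 2 * I * ρ)) ((q : ℂ) ^ 2) m := by
  rw [psiQ, jostSum, ← tsum_mul_left, qpow_mul_natCast]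
  refine tsum_congr fun k ↦ ?_
  have e : qpow q (2 - 4 * I * ρ) = qpow q (1 - 2 * I * ρ) ^ 2 := by
    rw [← qpow_mul_natCast]; congr 1; push_cast; ring
  rw [psiTerm, jostCoeff, e]
  ring

lemma phiQ_eq_sphSum (q : ℝ) (ρ : ℂ) (m : ℕ) :
    phiQ q ρ m = sphSum (qpow q (1 - 2 * I * ρ)) (qpow q (1 + 2 * I * ρ)) ((q : ℂ) ^ 2)
      (((q : ℂ) ^ 2)⁻¹ ^ m) (m + 1) := by
  refine Finset.sum_congr rfl fun k _ ↦ ?_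
  have e : (q : ℂ) ^ (-(2 * (m : ℤ))) = ((q : ℂ) ^ 2)⁻¹ ^ m := by
    rw [zpow_neg, inv_pow, ← pow_mul]; norm_cast
  rw [e, sphCoeff]
  ring

lemma qGamma_div_sq_eq_connCoeff (hQ : ‖(q : ℂ) ^ 2‖ < 1) (ρ : ℂ) :
    qGamma q (2 * I * ρ) / qGamma q (1 / 2 + I * ρ) ^ 2
      = connCoeff (qpow q (1 - 2 * I * ρ)) (qpow q (1 + 2 * I * ρ)) ((q : ℂ) ^ 2) := by
  have hPQ := qPochInf_ne_zero hQ (one_sub_mul_self_pow_ne_zero hQ)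
  have h1 : (1 : ℂ) - (q : ℂ) ^ 2 ≠ 0 := by simpa using one_sub_pow_succ_ne_zero hQ 0
  have e1 : ((1 : ℂ) - (q : ℂ) ^ 2) ^ ((1 : ℂ) - 2 * I * ρ)
      = (((1 : ℂ) - (q : ℂ) ^ 2) ^ ((1 : ℂ) - (1 / 2 + I * ρ))) ^ 2 := by
    rw [← Complex.cpow_nat_mul]; congr 1; push_cast; ring
  have h2 : ((1 : ℂ) - (q : ℂ) ^ 2) ^ ((1 : ℂ) - (1 / 2 + I * ρ)) ≠ 0 := by
    simp [Complex.cpow_eq_zero_iff, h1]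
  rw [qGamma, qGamma, connCoeff, e1, ← qpow_sub,
    show 1 + 2 * I * ρ - (1 - 2 * I * ρ) = 2 * (2 * I * ρ) by ring,
    show 2 * (1 / 2 + I * ρ) = 1 + 2 * I * ρ by ring]
  generalize ((1 : ℂ) - (q : ℂ) ^ 2) ^ ((1 : ℂ) - (1 / 2 + I * ρ)) = c at *
  generalize qPochInf ((q : ℂ) ^ 2) ((q : ℂ) ^ 2) = P at *
  have h3 := mul_ne_zero hPQ (pow_ne_zero 2 h2)
  rw [div_pow, mul_pow, div_div_div_eq, ← mul_div_mul_left (_ ^ 2) _ h3]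
  ring

end QPow

/-- decomposition of the q-spherical function into Jost-type solutions:
`φ_ρ = [Γ_{q²}(2iρ)/Γ_{q²}(1/2+iρ)²] ψ_ρ + [Γ_{q²}(−2iρ)/Γ_{q²}(1/2−iρ)²] ψ_{−ρ}`. -/
theorem phiQ_decomposition (q : ℝ) (hq : q ∈ Set.Ioo (0 : ℝ) 1) (ρ : ℂ)
    (hρ₁ : ∀ j : ℕ, 1 - qpow q (2 - 4 * I * ρ + 2 * (j : ℂ)) ≠ 0)
    (hρ₂ : ∀ j : ℕ, 1 - qpow q (2 + 4 * I * ρ + 2 * (j : ℂ)) ≠ 0)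
    (hρ₃ : qPochInf (qpow q (4 * I * ρ)) ((q : ℂ) ^ 2) ≠ 0)
    (hρ₄ : qPochInf (qpow q (-(4 * I * ρ))) ((q : ℂ) ^ 2) ≠ 0) :
    ∀ m : ℕ,
      phiQ q ρ m
        = qGamma q (2 * I * ρ) / (qGamma q (1 / 2 + I * ρ)) ^ 2 * psiQ q ρ m
          + qGamma q (-(2 * I * ρ)) / (qGamma q (1 / 2 - I * ρ)) ^ 2 * psiQ q (-ρ) m := by
  intro m
  obtain ⟨hq0, hq1⟩ := hq
  have hQ : ‖(q : ℂ) ^ 2‖ < 1 := by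
    rw [norm_pow, Complex.norm_real, Real.norm_of_nonneg hq0.le]
    exact pow_lt_one₀ hq0.le hq1 two_ne_zero
  have hab : qpow q (1 - 2 * I * ρ) * qpow q (1 + 2 * I * ρ) = (q : ℂ) ^ 2 := by
    rw [← qpow_add, ← qpow_two hq0]; congr 1; ring
  rw [show 4 * I * ρ = 1 + 2 * I * ρ - (1 - 2 * I * ρ) by ring, qpow_sub] at hρ₃
  rw [show -(4 * I * ρ) = 1 - 2 * I * ρ - (1 + 2 * I * ρ) by ring, qpow_sub] at hρ₄
  have hG := qGamma_div_sq_eq_connCoeff hQ (-ρ)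
  simp only [mul_neg, sub_neg_eq_add, ← sub_eq_add_neg] at hG
  rw [phiQ_eq_sphSum, psiQ_eq_jostSum, psiQ_eq_jostSum, qGamma_div_sq_eq_connCoeff hQ, hG,
    mul_neg, sub_neg_eq_add]
  exact sphSum_eq_connCoeff hQ hab (qpow_ne_zero q _) (qpow_ne_zero q _) hρ₃ hρ₄ m

end
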